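/- arXiv:2408.09855 — 2 statements merged into one kernel-verified Lean document; each statement's English description precedes it below -/
import Mathlib

section
/- For every m ≥ 1 there exists a unique unital ℂ-algebra homomorphism from the Hecke algebra H_m to End((ℂⁿ)^{⊗m}) sending T_k to Ř_k for k = 1, …, m−1, where Ř_k denotes Ř acting in the k-th and (k+1)-st tensor factors and as the identity in the remaining factors. -/
open scoped Classical

noncomputable section

namespace QImm

/-- `q` is not a root of unity. -/
def NotRootOfUnity (q : ℂ) : Prop := ∀ k : ℕ, 0 < k → q ^ k ≠ 1

/-! ### The R-matrices -/

/-- The R-matrix `R = q ∑ eᵢᵢ⊗eᵢᵢ + ∑_{i≠j} eᵢᵢ⊗eⱼⱼ + (q-q⁻¹) ∑_{i<j} eᵢⱼ⊗eⱼᵢ`. -/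
def Rmat (q : ℂ) (n : ℕ) : Matrix (Fin n × Fin n) (Fin n × Fin n) ℂ := fun p r =>
  if p.1 = r.1 ∧ p.2 = r.2 then (if p.1 = p.2 then q else 1)
  else if p.2 = r.1 ∧ p.1 = r.2 ∧ p.1 < r.1 then q - q⁻¹ else 0

/-- The permutation operator `P = ∑ eᵢⱼ⊗eⱼᵢ`. -/
def Pmat (n : ℕ) : Matrix (Fin n × Fin n) (Fin n × Fin n) ℂ := fun p r =>
  if p.1 = r.2 ∧ p.2 = r.1 then 1 else 0

/-- `Ř = P R`. -/
def Rcheck (q : ℂ) (n : ℕ) : Matrix (Fin n × Fin n) (Fin n × Fin n) ℂ :=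
  Pmat n * Rmat q n

/-! ### Embeddings into tensor legs: `(End ℂⁿ)^{⊗m} ⊗ A ≅ Matrix (Fin m → Fin n) (Fin m → Fin n) A` -/

/-- An `n×n` matrix over `A` placed in the `a`-th tensor leg (0-indexed) of
`(End ℂⁿ)^{⊗m} ⊗ A`. -/
def leg1 {A : Type} [Ring A] (n m : ℕ) (X : Matrix (Fin n) (Fin n) A) (a : ℕ) :
    Matrix (Fin m → Fin n) (Fin m → Fin n) A := fun i j =>
  if h : a < m then
    if ∀ c : Fin m, (c : ℕ) ≠ a → i c = j c then X (i ⟨a, h⟩) (j ⟨a, h⟩) else 0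
  else 0

/-- A scalar element of `End ℂⁿ ⊗ End ℂⁿ` placed in the `a`-th and `b`-th tensor legs
(0-indexed) of `(End ℂⁿ)^{⊗m} ⊗ A`. -/
def leg2 (A : Type) [Ring A] [Algebra ℂ A] (n m : ℕ)
    (C : Matrix (Fin n × Fin n) (Fin n × Fin n) ℂ) (a b : ℕ) :
    Matrix (Fin m → Fin n) (Fin m → Fin n) A := fun i j =>
  if h : a < m ∧ b < m then
    if ∀ c : Fin m, (c : ℕ) ≠ a → (c : ℕ) ≠ b → i c = j c then
      algebraMap ℂ A (C (i ⟨a, h.1⟩, i ⟨b, h.2⟩) (j ⟨a, h.1⟩, j ⟨b, h.2⟩))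
    else 0
  else 0

/-- `Ř_{k+1}` (paper numbering), acting in the tensor legs `k`, `k+1` (0-indexed). -/
def RcLeg (A : Type) [Ring A] [Algebra ℂ A] (q : ℂ) (n m : ℕ) (k : ℕ) :
    Matrix (Fin m → Fin n) (Fin m → Fin n) A :=
  leg2 A n m (Rcheck q n) k (k + 1)

/-- `Ř⁻¹_{k+1}` (paper numbering), acting in the tensor legs `k`, `k+1` (0-indexed). -/
def RcLegInv (A : Type) [Ring A] [Algebra ℂ A] (q : ℂ) (n m : ℕ) (k : ℕ) :
    Matrix (Fin m → Fin n) (Fin m → Fin n) A :=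
  leg2 A n m (Rcheck q n)⁻¹ k (k + 1)

/-- `legBar q n m X k` is `X_{\overline{k+1}}` (paper numbering), so `legBar q n m X 0 = X₁`
and `X_{\overline{k+1}} = Ř_k X_{\overline{k}} Ř_k⁻¹`. -/
def legBar {A : Type} [Ring A] [Algebra ℂ A] (q : ℂ) (n m : ℕ)
    (X : Matrix (Fin n) (Fin n) A) : ℕ → Matrix (Fin m → Fin n) (Fin m → Fin n) A
  | 0 => leg1 n m X 0
  | k + 1 => RcLeg A q n m k * legBar q n m X k * RcLegInv A q n m k

/-! ### q-traces -/

/-- The q-trace over all `m` tensor legs: `tr_{q(1,…,m)} Y = tr D₁⋯D_m Y` with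
`D = diag(1, q⁻², …, q^{-2n+2})`. -/
def qTr {A : Type} [Ring A] [Algebra ℂ A] (q : ℂ) (n m : ℕ)
    (Y : Matrix (Fin m → Fin n) (Fin m → Fin n) A) : A :=
  ∑ i : Fin m → Fin n,
    algebraMap ℂ A (∏ a : Fin m, q ^ (-2 * ((i a : ℕ) : ℤ))) * Y i i

/-- The q-trace of a single `n×n` matrix: `tr_q X = tr D X`. -/
def qTr1 {A : Type} [Ring A] [Algebra ℂ A] (q : ℂ) (n : ℕ)
    (X : Matrix (Fin n) (Fin n) A) : A :=
  ∑ j : Fin n, algebraMap ℂ A (q ^ (-2 * ((j : ℕ) : ℤ))) * X j j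

/-! ### The Hecke algebra -/

/-- The defining relations of the Hecke algebra `H_m` on generators `T_1, …, T_{m-1}`
(the generator `i : Fin (m-1)` is `T_{i+1}` in 1-indexed paper notation). -/
inductive HeckeRel (q : ℂ) (m : ℕ) :
    FreeAlgebra ℂ (Fin (m - 1)) → FreeAlgebra ℂ (Fin (m - 1)) → Prop
  | quad (i : Fin (m - 1)) :
      HeckeRel q m
        ((FreeAlgebra.ι ℂ i - algebraMap ℂ (FreeAlgebra ℂ (Fin (m - 1))) q) *
          (FreeAlgebra.ι ℂ i + algebraMap ℂ (FreeAlgebra ℂ (Fin (m - 1))) q⁻¹)) 0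
  | braid (i j : Fin (m - 1)) (h : (j : ℕ) = (i : ℕ) + 1) :
      HeckeRel q m (FreeAlgebra.ι ℂ i * FreeAlgebra.ι ℂ j * FreeAlgebra.ι ℂ i)
        (FreeAlgebra.ι ℂ j * FreeAlgebra.ι ℂ i * FreeAlgebra.ι ℂ j)
  | commute (i j : Fin (m - 1)) (h : (i : ℕ) + 1 < (j : ℕ)) :
      HeckeRel q m (FreeAlgebra.ι ℂ i * FreeAlgebra.ι ℂ j)
        (FreeAlgebra.ι ℂ j * FreeAlgebra.ι ℂ i)

/-- The Hecke algebra `H_m`. -/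
abbrev Hecke (q : ℂ) (m : ℕ) := RingQuot (HeckeRel q m)

/-- The generator `T_{i+1}` (paper 1-indexed) of `H_m`. -/
def Tgen (q : ℂ) (m : ℕ) (i : Fin (m - 1)) : Hecke q m :=
  RingQuot.mkAlgHom ℂ (HeckeRel q m) (FreeAlgebra.ι ℂ i)

/-- `T_{k+1}` (paper 1-indexed), i.e. the 0-indexed `k`-th generator; junk value `1`
out of range. -/
def Tn (q : ℂ) (m : ℕ) (k : ℕ) : Hecke q m :=
  if h : k < m - 1 then Tgen q m ⟨k, h⟩ else 1

/-- The paper's 1-indexed generator `T_a`, `a = 1, …, m-1`. -/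
def Tp (q : ℂ) (m : ℕ) (a : ℕ) : Hecke q m := Tn q m (a - 1)

/-- The Jucys–Murphy elements, 1-indexed: `y_1 = 1`, `y_{k+1} = T_k ⋯ T_2 T_1² T_2 ⋯ T_k`
(the value at `0` is a junk value `1`). -/
def yJM (q : ℂ) (m : ℕ) : ℕ → Hecke q m
  | 0 => 1
  | 1 => 1
  | k + 2 => Tp q m (k + 1) * yJM q m (k + 1) * Tp q m (k + 1)

/-- The element `T_{(i,j)} = T_i T_{i+1} ⋯ T_{j-2} T_{j-1} T_{j-2} ⋯ T_{i+1} T_i` of `H_m`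
associated with the transposition `(i,j)`, `1 ≤ i < j` (paper 1-indexed). -/
def Ttrans (q : ℂ) (m : ℕ) (i j : ℕ) : Hecke q m :=
  ((List.range' i (j - i)).map (Tp q m)).prod *
    (((List.range' i (j - 1 - i)).map (Tp q m)).reverse).prod

/-- The condition that `φ : H_m → End((ℂⁿ)^{⊗m})` is the algebra homomorphism sending
`T_k ↦ Ř_k`. -/
def IsHeckeRep (q : ℂ) (n m : ℕ)
    (φ : Hecke q m →ₐ[ℂ] Matrix (Fin m → Fin n) (Fin m → Fin n) ℂ) : Prop :=
  ∀ k : ℕ, k < m - 1 → φ (Tn q m k) = RcLeg ℂ q n m k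

/-! ### Young diagrams and standard tableaux -/

/-- The content `c(α) = j - i` of a box `α = (i, j)` (row `i`, column `j`, 0-indexed). -/
def ctn (α : ℕ × ℕ) : ℤ := (α.2 : ℤ) - (α.1 : ℤ)

/-- A standard tableau of shape `μ` with `m` boxes, recorded via the position `pos k` of
each entry `k ∈ {1, …, m}`; entries strictly increase along rows and down columns. -/
structure StdTab (μ : YoungDiagram) (m : ℕ) where
  pos : ℕ → ℕ × ℕ
  bij : Set.BijOn pos (Set.Icc 1 m) (μ.cells : Set (ℕ × ℕ))
  row_lt : ∀ k ∈ Set.Icc 1 m, ∀ l ∈ Set.Icc 1 m,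
    (pos k).1 = (pos l).1 → (pos k).2 < (pos l).2 → k < l
  col_lt : ∀ k ∈ Set.Icc 1 m, ∀ l ∈ Set.Icc 1 m,
    (pos k).2 = (pos l).2 → (pos k).1 < (pos l).1 → k < l

/-- `c_k(U)`, the content of the box of `U` occupied by `k`. -/
def ctnAt {μ : YoungDiagram} {m : ℕ} (U : StdTab μ m) (k : ℕ) : ℤ := ctn (U.pos k)

/-- The condition singling out the primitive idempotent `e_U` of `H_m` associated with a
standard tableau `U`: a nonzero idempotent with `y_k e_U = e_U y_k = q^{2c_k(U)} e_U`. -/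
def IsJMIdem (q : ℂ) (m : ℕ) {μ : YoungDiagram} (U : StdTab μ m) (e : Hecke q m) : Prop :=
  e ≠ 0 ∧ e * e = e ∧ ∀ k : ℕ, 1 ≤ k → k ≤ m →
    yJM q m k * e = (q ^ (2 * ctnAt U k) : ℂ) • e ∧
    e * yJM q m k = (q ^ (2 * ctnAt U k) : ℂ) • e

/-! ### The quantized enveloping algebra `U_q(gl_n)` -/

/-- Generators: `inl (i,j) ↦ l⁺_{ij}`, `inr (i,j) ↦ l⁻_{ij}`. -/
abbrev UqGen (n : ℕ) := (Fin n × Fin n) ⊕ (Fin n × Fin n)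

def lpF (n : ℕ) (i j : Fin n) : FreeAlgebra ℂ (UqGen n) := FreeAlgebra.ι ℂ (Sum.inl (i, j))
def lmF (n : ℕ) (i j : Fin n) : FreeAlgebra ℂ (UqGen n) := FreeAlgebra.ι ℂ (Sum.inr (i, j))

/-- A matrix `X` over `F` placed in the first of two matrix legs of
`End ℂⁿ ⊗ End ℂⁿ ⊗ F`. -/
def M1 {F : Type} [Ring F] {n : ℕ} (X : Fin n → Fin n → F) :
    Matrix (Fin n × Fin n) (Fin n × Fin n) F := fun p r => if p.2 = r.2 then X p.1 r.1 else 0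

/-- A matrix `X` over `F` placed in the second of two matrix legs of
`End ℂⁿ ⊗ End ℂⁿ ⊗ F`. -/
def M2 {F : Type} [Ring F] {n : ℕ} (X : Fin n → Fin n → F) :
    Matrix (Fin n × Fin n) (Fin n × Fin n) F := fun p r => if p.1 = r.1 then X p.2 r.2 else 0

/-- The R-matrix, viewed over the free algebra on the generators of `U_q(gl_n)`. -/
def RmatU (q : ℂ) (n : ℕ) : Matrix (Fin n × Fin n) (Fin n × Fin n) (FreeAlgebra ℂ (UqGen n)) :=
  (Rmat q n).map (algebraMap ℂ (FreeAlgebra ℂ (UqGen n)))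

/-- The defining relations of `U_q(gl_n)`. -/
inductive UqRel (q : ℂ) (n : ℕ) :
    FreeAlgebra ℂ (UqGen n) → FreeAlgebra ℂ (UqGen n) → Prop
  | upperZero (i j : Fin n) (h : j < i) : UqRel q n (lpF n i j) 0
  | lowerZero (i j : Fin n) (h : i < j) : UqRel q n (lmF n i j) 0
  | diagPM (i : Fin n) : UqRel q n (lpF n i i * lmF n i i) 1
  | diagMP (i : Fin n) : UqRel q n (lmF n i i * lpF n i i) 1
  | rllPP (x y : Fin n × Fin n) :
      UqRel q n ((RmatU q n * M1 (lpF n) * M2 (lpF n)) x y)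
        ((M2 (lpF n) * M1 (lpF n) * RmatU q n) x y)
  | rllMM (x y : Fin n × Fin n) :
      UqRel q n ((RmatU q n * M1 (lmF n) * M2 (lmF n)) x y)
        ((M2 (lmF n) * M1 (lmF n) * RmatU q n) x y)
  | rllPM (x y : Fin n × Fin n) :
      UqRel q n ((RmatU q n * M1 (lpF n) * M2 (lmF n)) x y)
        ((M2 (lmF n) * M1 (lpF n) * RmatU q n) x y)

/-- The quantized enveloping algebra `U_q(gl_n)`. -/
abbrev Uq (q : ℂ) (n : ℕ) := RingQuot (UqRel q n)

def lp (q : ℂ) (n : ℕ) (i j : Fin n) : Uq q n := RingQuot.mkAlgHom ℂ (UqRel q n) (lpF n i j)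
def lm (q : ℂ) (n : ℕ) (i j : Fin n) : Uq q n := RingQuot.mkAlgHom ℂ (UqRel q n) (lmF n i j)

/-- The matrix `L⁺`. -/
def Lp (q : ℂ) (n : ℕ) : Matrix (Fin n) (Fin n) (Uq q n) := Matrix.of fun i j => lp q n i j
/-- The matrix `L⁻`. -/
def Lm (q : ℂ) (n : ℕ) : Matrix (Fin n) (Fin n) (Uq q n) := Matrix.of fun i j => lm q n i j

/-- `L = L⁺ (L⁻)⁻¹`, where `K` is the (two-sided) inverse of `L⁻`. -/
def Lmat (q : ℂ) (n : ℕ) (K : Matrix (Fin n) (Fin n) (Uq q n)) :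
    Matrix (Fin n) (Fin n) (Uq q n) := Lp q n * K

/-! ### The braided Weyl algebra -/

/-- Generators: `inl (i,j) ↦ m_{ij}`, `inr (i,j) ↦ ∂_{ij}`. -/
abbrev WGen (n : ℕ) := (Fin n × Fin n) ⊕ (Fin n × Fin n)

def mgF (n : ℕ) (i j : Fin n) : FreeAlgebra ℂ (WGen n) := FreeAlgebra.ι ℂ (Sum.inl (i, j))
def dgF (n : ℕ) (i j : Fin n) : FreeAlgebra ℂ (WGen n) := FreeAlgebra.ι ℂ (Sum.inr (i, j))

def RcW (q : ℂ) (n : ℕ) : Matrix (Fin n × Fin n) (Fin n × Fin n) (FreeAlgebra ℂ (WGen n)) :=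
  (Rcheck q n).map (algebraMap ℂ (FreeAlgebra ℂ (WGen n)))

def RcWInv (q : ℂ) (n : ℕ) : Matrix (Fin n × Fin n) (Fin n × Fin n) (FreeAlgebra ℂ (WGen n)) :=
  ((Rcheck q n)⁻¹).map (algebraMap ℂ (FreeAlgebra ℂ (WGen n)))

/-- The defining relations of the braided Weyl algebra `W_n`. -/
inductive WRel (q : ℂ) (n : ℕ) :
    FreeAlgebra ℂ (WGen n) → FreeAlgebra ℂ (WGen n) → Prop
  | mm (x y : Fin n × Fin n) :
      WRel q n ((RcW q n * M1 (mgF n) * RcW q n * M1 (mgF n)) x y)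
        ((M1 (mgF n) * RcW q n * M1 (mgF n) * RcW q n) x y)
  | dd (x y : Fin n × Fin n) :
      WRel q n ((RcWInv q n * M1 (dgF n) * RcWInv q n * M1 (dgF n)) x y)
        ((M1 (dgF n) * RcWInv q n * M1 (dgF n) * RcWInv q n) x y)
  | dm (x y : Fin n × Fin n) :
      WRel q n ((M1 (dgF n) * RcW q n * M1 (mgF n)) x y)
        ((RcW q n * M1 (mgF n) * RcWInv q n * M1 (dgF n) * RcWInv q n + 1) x y)

/-- The braided Weyl algebra `W_n`. -/
abbrev Weyl (q : ℂ) (n : ℕ) := RingQuot (WRel q n)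

def mW (q : ℂ) (n : ℕ) (i j : Fin n) : Weyl q n := RingQuot.mkAlgHom ℂ (WRel q n) (mgF n i j)
def dW (q : ℂ) (n : ℕ) (i j : Fin n) : Weyl q n := RingQuot.mkAlgHom ℂ (WRel q n) (dgF n i j)

/-- The matrix `M = [m_{ij}]` over `W_n`. -/
def Mmat (q : ℂ) (n : ℕ) : Matrix (Fin n) (Fin n) (Weyl q n) := Matrix.of fun i j => mW q n i j
/-- The matrix `𝒟 = [∂_{ij}]` over `W_n`. -/
def Dmat (q : ℂ) (n : ℕ) : Matrix (Fin n) (Fin n) (Weyl q n) := Matrix.of fun i j => dW q n i j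

/-- The image `L = M𝒟 - (q - q⁻¹)⁻¹·1` of `L` in the braided Weyl algebra. -/
def LW (q : ℂ) (n : ℕ) : Matrix (Fin n) (Fin n) (Weyl q n) :=
  Mmat q n * Dmat q n - ((q - q⁻¹)⁻¹ : ℂ) • 1

/-! ### The q-immanant polynomials -/

/-- The matrix `(L_{1̄} + z q^{-2c₁(U)}) ⋯ (L_{m̄} + z q^{-2c_m(U)}) E_U`, where `E` is the
image `E_U` of the primitive idempotent `e_U`. -/
def prodU {A : Type} [Ring A] [Algebra ℂ A] (q : ℂ) (n m : ℕ) {μ : YoungDiagram}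
    (U : StdTab μ m) (E : Matrix (Fin m → Fin n) (Fin m → Fin n) ℂ)
    (X : Matrix (Fin n) (Fin n) A) (z : ℂ) :
    Matrix (Fin m → Fin n) (Fin m → Fin n) A :=
  (((List.range m).map fun k =>
      legBar q n m X k + ((z * q ^ (-2 * ctnAt U (k + 1))) : ℂ) • 1)).prod *
    E.map (algebraMap ℂ A)

/-- The q-immanant polynomial
`S_U(z) = tr_{q(1,…,m)} (L_{1̄} + z q^{-2c₁(U)}) ⋯ (L_{m̄} + z q^{-2c_m(U)}) E_U`. -/
def SUpoly {A : Type} [Ring A] [Algebra ℂ A] (q : ℂ) (n m : ℕ) {μ : YoungDiagram}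
    (U : StdTab μ m) (E : Matrix (Fin m → Fin n) (Fin m → Fin n) ℂ)
    (X : Matrix (Fin n) (Fin n) A) (z : ℂ) : A :=
  qTr q n m (prodU q n m U E X z)

/-- The coefficient `a_μ = ∏_{α ∈ μ} q^{-2c(α)}`. -/
def aCoeff (q : ℂ) (μ : YoungDiagram) : ℂ := ∏ α ∈ μ.cells, q ^ (-2 * ctn α)

/-- `tr_{q(1,…,m)} L_{1̄} ⋯ L_{m̄} E_{(1^m)}`, where `Em` is the image of the primitive
idempotent associated with the column diagram `(1^m)`. -/
def colElem (q : ℂ) (n k : ℕ) (K : Matrix (Fin n) (Fin n) (Uq q n))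
    (φk : Hecke q k →ₐ[ℂ] Matrix (Fin k → Fin n) (Fin k → Fin n) ℂ)
    (ek : Hecke q k) : Uq q n :=
  qTr q n k (((List.range k).map fun j => legBar q n k (Lmat q n K) j).prod *
    (φk ek).map (algebraMap ℂ (Uq q n)))

/-- The semistandardness condition on a filling of the boxes of `μ` with entries in
`{1, …, n}` (encoded as `Fin n`): weakly increasing along rows, strictly increasing
down columns. -/
def SSYTCond {n : ℕ} (μ : YoungDiagram) (f : {x // x ∈ μ.cells} → Fin n) : Prop :=
  (∀ a b : {x // x ∈ μ.cells}, (a : ℕ × ℕ).1 = (b : ℕ × ℕ).1 →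
    (a : ℕ × ℕ).2 ≤ (b : ℕ × ℕ).2 → f a ≤ f b) ∧
  (∀ a b : {x // x ∈ μ.cells}, (a : ℕ × ℕ).2 = (b : ℕ × ℕ).2 →
    (a : ℕ × ℕ).1 < (b : ℕ × ℕ).1 → f a < f b)

/-- The factorial Schur polynomial `s_μ(x₁,…,x_n | a)` evaluated at `x_i = q^{2ℓ_i}`,
`ℓ_i = λ_i - i + 1` (1-indexed), with parameter sequence `a_j = z q^{1-2j}`. -/
def factSchur {n : ℕ} (q z : ℂ) (lam : Fin n → ℤ) (μ : YoungDiagram) : ℂ :=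
  ∑ f : {x // x ∈ μ.cells} → Fin n,
    if SSYTCond μ f then
      ∏ α : {x // x ∈ μ.cells},
        (q ^ (2 * (lam (f α) - ((f α : ℕ) : ℤ))) +
          z * q ^ (1 - 2 * (((f α : ℕ) : ℤ) + 1 + ctn (α : ℕ × ℕ))))
    else 0

/-- The operator on functions of words `w : ι → α` given by `Ř` acting on the letters in
positions `a` and `b`. -/
def braidOp {ι α : Type*} [DecidableEq ι] [LinearOrder α] (q : ℂ) (a b : ι) (v : (ι → α) → ℂ) : (ι → α) → ℂ :=
  fun w =>
    if w a = w b then q * v w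
    else v (w ∘ Equiv.swap a b) + if w b < w a then (q - q⁻¹) * v w else 0

theorem comp_swap_comp_swap {ι α : Type*} [DecidableEq ι] (a b : ι) (w : ι → α) :
    (w ∘ Equiv.swap a b) ∘ Equiv.swap a b = w := by
  ext c; simp

section braidOp

variable {ι α : Type*} [DecidableEq ι] [LinearOrder α] (q : ℂ)

theorem braidOp_braidOp (hq : q ≠ 0) (a b : ι) (v : (ι → α) → ℂ) :
    braidOp q a b (braidOp q a b v) = (q - q⁻¹) • braidOp q a b v + v := by
  ext w
  rcases lt_trichotomy (w a) (w b) with h | h | h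
  · simp [braidOp, comp_swap_comp_swap, h, h.ne, h.ne', h.not_gt]
    ring
  · simp [braidOp, h]
    field_simp
    ring
  · simp [braidOp, comp_swap_comp_swap, h, h.ne, h.ne', h.not_gt]
    ring

theorem braidOp_braid (hq : q ≠ 0) {a b c : ι} (hab : a ≠ b) (hac : a ≠ c) (hbc : b ≠ c)
    (v : (ι → α) → ℂ) :
    braidOp q a b (braidOp q b c (braidOp q a b v)) =
      braidOp q b c (braidOp q a b (braidOp q b c v)) := by
  ext w
  have hs : ((w ∘ Equiv.swap a b) ∘ Equiv.swap b c) ∘ Equiv.swap a b =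
      ((w ∘ Equiv.swap b c) ∘ Equiv.swap a b) ∘ Equiv.swap b c := by
    ext d
    simp only [Function.comp_apply, Equiv.swap_apply_def]
    grind
  have h1 : Equiv.swap a b c = c := Equiv.swap_apply_of_ne_of_ne hac.symm hbc.symm
  have h2 : Equiv.swap b c a = a := Equiv.swap_apply_of_ne_of_ne hab hac
  simp only [braidOp, Function.comp_apply, Equiv.swap_apply_left, Equiv.swap_apply_right, h1, h2]
  simp only [comp_swap_comp_swap, hs]
  generalize w a = x
  generalize w b = y
  generalize w c = z
  have hxy := lt_trichotomy x y
  have hyz := lt_trichotomy y z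
  have hxz := lt_trichotomy x z
  rcases hxy with hxy | rfl | hxy <;>
  rcases hyz with hyz | rfl | hyz <;>
  rcases hxz with hxz | hxz | hxz <;>
  first
  | (exfalso; order)
  | (try subst hxz
     simp only [*, lt_irrefl, ne_of_lt, ne_of_gt, not_lt_of_gt, if_true, if_false]
     try field_simp
     try ring)

theorem braidOp_comm {a b c d : ι} (hac : a ≠ c) (had : a ≠ d) (hbc : b ≠ c) (hbd : b ≠ d)
    (v : (ι → α) → ℂ) :
    braidOp q a b (braidOp q c d v) = braidOp q c d (braidOp q a b v) := by
  ext w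
  have hs : (w ∘ Equiv.swap a b) ∘ Equiv.swap c d = (w ∘ Equiv.swap c d) ∘ Equiv.swap a b := by
    have hdis : Commute (Equiv.swap a b) (Equiv.swap c d) :=
      (Equiv.Perm.disjoint_iff_eq_or_eq.2 fun e => by
        by_cases hea : e = a
        · exact Or.inr (hea ▸ Equiv.swap_apply_of_ne_of_ne hac had)
        by_cases heb : e = b
        · exact Or.inr (heb ▸ Equiv.swap_apply_of_ne_of_ne hbc hbd)
        exact Or.inl (Equiv.swap_apply_of_ne_of_ne hea heb)).commute
    ext e
    exact congrArg w (congrArg (fun σ : Equiv.Perm ι => σ e) hdis.eq)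
  have h1 := Equiv.swap_apply_of_ne_of_ne hac had
  have h2 := Equiv.swap_apply_of_ne_of_ne hbc hbd
  have h3 := Equiv.swap_apply_of_ne_of_ne hac.symm hbc.symm
  have h4 := Equiv.swap_apply_of_ne_of_ne had.symm hbd.symm
  simp only [braidOp, Function.comp_apply, h1, h2, h3, h4, hs]
  split_ifs <;> ring

end braidOp

theorem Rcheck_apply (q : ℂ) (n : ℕ) (p r : Fin n × Fin n) :
    Rcheck q n p r = Rmat q n p.swap r := by
  rw [Rcheck, Matrix.mul_apply, Finset.sum_eq_single p.swap]
  · simp [Pmat]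
  · rintro ⟨x, y⟩ - h
    have : ¬(p.1 = y ∧ p.2 = x) := fun ⟨h1, h2⟩ => h (by simp [Prod.swap, h1, h2])
    simp [Pmat, this]
  · simp

theorem leg2_apply {n m k : ℕ} (hk : k + 1 < m) (C : Matrix (Fin n × Fin n) (Fin n × Fin n) ℂ)
    (i j : Fin m → Fin n) {a b : Fin m} (ha : (a : ℕ) = k) (hb : (b : ℕ) = k + 1) :
    leg2 ℂ n m C k (k + 1) i j =
      if ∀ c, c ≠ a → c ≠ b → i c = j c then C (i a, i b) (j a, j b) else 0 := by
  have ha' : (⟨k, by omega⟩ : Fin m) = a := Fin.ext ha.symm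
  have hb' : (⟨k + 1, hk⟩ : Fin m) = b := Fin.ext hb.symm
  simp [leg2, hk, Nat.lt_of_succ_lt hk, Fin.ext_iff, ha, hb, ha', hb']

theorem eq_comp_swap_iff {ι α : Type*} [DecidableEq ι] {a b : ι} (i j : ι → α) :
    j = i ∘ Equiv.swap a b ↔ (∀ c, c ≠ a → c ≠ b → i c = j c) ∧ j a = i b ∧ j b = i a := by
  constructor
  · rintro rfl
    refine ⟨fun c hca hcb => ?_, by simp, by simp⟩
    simp [Equiv.swap_apply_of_ne_of_ne hca hcb]
  · rintro ⟨h, h1, h2⟩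
    ext c
    by_cases hca : c = a
    · simp [hca, h1]
    by_cases hcb : c = b
    · simp [hcb, h2]
    simp [Equiv.swap_apply_of_ne_of_ne hca hcb, h c hca hcb]

theorem eq_iff_eq_off {ι α : Type*} {a b : ι} (i j : ι → α) :
    j = i ↔ (∀ c, c ≠ a → c ≠ b → i c = j c) ∧ j a = i a ∧ j b = i b := by
  constructor
  · rintro rfl; simp
  · rintro ⟨h, h1, h2⟩
    ext c
    by_cases hca : c = a
    · rw [hca, h1]
    by_cases hcb : c = b
    · rw [hcb, h2]
    rw [h c hca hcb]

theorem RcLeg_apply (q : ℂ) {n m k : ℕ} {a b : Fin m} (ha : (a : ℕ) = k) (hb : (b : ℕ) = k + 1)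
    (i j : Fin m → Fin n) :
    RcLeg ℂ q n m k i j =
      if i a = i b then (if j = i then q else 0)
      else (if j = i ∘ Equiv.swap a b then 1 else 0) +
        if i b < i a then (if j = i then q - q⁻¹ else 0) else 0 := by
  simp only [RcLeg, leg2_apply (hb ▸ b.2) _ i j ha hb, eq_comp_swap_iff,
    eq_iff_eq_off (a := a) (b := b) i j]
  by_cases h : ∀ c, c ≠ a → c ≠ b → i c = j c
  · simp only [if_pos h, Rcheck_apply, Rmat, Prod.fst_swap, Prod.snd_swap]
    grind
  · simp [h]

theorem RcLeg_mulVec (q : ℂ) {n m k : ℕ} {a b : Fin m} (ha : (a : ℕ) = k)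
    (hb : (b : ℕ) = k + 1) (v : (Fin m → Fin n) → ℂ) :
    (RcLeg ℂ q n m k).mulVec v = braidOp q a b v := by
  ext i
  simp only [Matrix.mulVec, dotProduct, RcLeg_apply q ha hb, braidOp]
  split_ifs <;> simp [add_mul, Finset.sum_add_distrib]

theorem RcLeg_quad {q : ℂ} (hq : q ≠ 0) (n : ℕ) {m k : ℕ} (hk : k + 1 < m) :
    (RcLeg ℂ q n m k - algebraMap ℂ _ q) * (RcLeg ℂ q n m k + algebraMap ℂ _ q⁻¹) = 0 := by
  have h : RcLeg ℂ q n m k * RcLeg ℂ q n m k = (q - q⁻¹) • RcLeg ℂ q n m k + 1 := by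
    refine Matrix.ext_of_mulVec_single fun j => ?_
    simp only [← Matrix.mulVec_mulVec, Matrix.add_mulVec, Matrix.smul_mulVec, Matrix.one_mulVec,
      RcLeg_mulVec q (a := ⟨k, by omega⟩) (b := ⟨k + 1, hk⟩) rfl rfl]
    exact braidOp_braidOp q hq _ _ _
  simp only [Algebra.algebraMap_eq_smul_one, sub_mul, mul_add, h, smul_mul_assoc, mul_smul_comm,
    one_mul, mul_one]
  match_scalars
  · ring
  · field_simp
    ring

theorem RcLeg_braid {q : ℂ} (hq : q ≠ 0) (n : ℕ) {m k : ℕ} (hk : k + 2 < m) :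
    RcLeg ℂ q n m k * RcLeg ℂ q n m (k + 1) * RcLeg ℂ q n m k =
      RcLeg ℂ q n m (k + 1) * RcLeg ℂ q n m k * RcLeg ℂ q n m (k + 1) := by
  refine Matrix.ext_of_mulVec_single fun j => ?_
  simp only [← Matrix.mulVec_mulVec,
    RcLeg_mulVec q (m := m) (k := k) (a := ⟨k, by omega⟩) (b := ⟨k + 1, by omega⟩) rfl rfl,
    RcLeg_mulVec q (m := m) (k := k + 1) (a := ⟨k + 1, by omega⟩) (b := ⟨k + 2, by omega⟩) rfl rfl]
  exact braidOp_braid q hq (by simp) (by simp) (by simp) _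

theorem RcLeg_comm (q : ℂ) (n : ℕ) {m k l : ℕ} (hkl : k + 1 < l) (hl : l + 1 < m) :
    RcLeg ℂ q n m k * RcLeg ℂ q n m l = RcLeg ℂ q n m l * RcLeg ℂ q n m k := by
  refine Matrix.ext_of_mulVec_single fun j => ?_
  simp only [← Matrix.mulVec_mulVec,
    RcLeg_mulVec q (m := m) (k := k) (a := ⟨k, by omega⟩) (b := ⟨k + 1, by omega⟩) rfl rfl,
    RcLeg_mulVec q (m := m) (k := l) (a := ⟨l, by omega⟩) (b := ⟨l + 1, by omega⟩) rfl rfl]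
  apply braidOp_comm <;> simp only [ne_eq, Fin.mk.injEq] <;> omega

/-- for every `m ≥ 1` there is a unique unital `ℂ`-algebra homomorphism
`H_m → End((ℂⁿ)^{⊗m})` with `T_k ↦ Ř_k` for `k = 1, …, m-1`. -/
theorem hecke_action_existsUnique (n : ℕ) (hn : 1 ≤ n) (q : ℂ) (hq : q ≠ 0)
    (hq' : NotRootOfUnity q) (m : ℕ) (hm : 1 ≤ m) :
    ∃! φ : Hecke q m →ₐ[ℂ] Matrix (Fin m → Fin n) (Fin m → Fin n) ℂ,
      IsHeckeRep q n m φ := by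
  have hrel : ∀ ⦃x y : FreeAlgebra ℂ (Fin (m - 1))⦄, HeckeRel q m x y →
      FreeAlgebra.lift ℂ (fun i : Fin (m - 1) => RcLeg ℂ q n m i) x =
        FreeAlgebra.lift ℂ (fun i : Fin (m - 1) => RcLeg ℂ q n m i) y := by
    rintro x y (i | ⟨i, j, h⟩ | ⟨i, j, h⟩)
    · simpa using RcLeg_quad hq n (m := m) (k := i) (by omega)
    · simpa [h] using RcLeg_braid hq n (m := m) (k := i) (by omega)
    · simpa using RcLeg_comm q n (m := m) h (by omega)
  refine ⟨RingQuot.liftAlgHom ℂ ⟨_, hrel⟩, fun k hk => ?_, fun φ hφ => ?_⟩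
  · simp [Tn, Tgen, hk]
  · refine RingQuot.ringQuot_ext' _ _ _ (FreeAlgebra.hom_ext (funext fun i => ?_))
    simpa [Tn, Tgen] using hφ i i.2

end QImm
end
end

section
/- In End(ℂⁿ) ⊗ End(ℂⁿ) ⊗ U_q(gl_n), the matrix L = L⁺(L⁻)⁻¹ satisfies the reflection equation Ř L₁ Ř L₁ = L₁ Ř L₁ Ř. -/
open scoped Classical

noncomputable section

namespace QImm

lemma M1_mul {F : Type} [Ring F] {n : ℕ} (X Y : Matrix (Fin n) (Fin n) F) :
    M1 (X * Y) = M1 X * M1 Y := by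
  ext ⟨a, b⟩ ⟨c, d⟩
  by_cases h : b = d <;> simp [M1, Matrix.mul_apply, Fintype.sum_prod_type, h]

lemma M2_mul {F : Type} [Ring F] {n : ℕ} (X Y : Matrix (Fin n) (Fin n) F) :
    M2 (X * Y) = M2 X * M2 Y := by
  ext ⟨a, b⟩ ⟨c, d⟩
  by_cases h : a = c <;> simp [M2, Matrix.mul_apply, Fintype.sum_prod_type, h]

lemma M1_one {F : Type} [Ring F] {n : ℕ} :
    M1 (1 : Matrix (Fin n) (Fin n) F) = 1 := by
  ext ⟨a, b⟩ ⟨c, d⟩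
  by_cases h : b = d <;> simp [M1, Matrix.one_apply, h]

lemma M2_one {F : Type} [Ring F] {n : ℕ} :
    M2 (1 : Matrix (Fin n) (Fin n) F) = 1 := by
  ext ⟨a, b⟩ ⟨c, d⟩
  by_cases h : a = c <;> simp [M2, Matrix.one_apply, h]

lemma Pmat_mul_M1 {A : Type} [Ring A] [Algebra ℂ A] {n : ℕ} (X : Fin n → Fin n → A) :
    (Pmat n).map (algebraMap ℂ A) * M1 X = M2 X * (Pmat n).map (algebraMap ℂ A) := by
  ext ⟨a, b⟩ ⟨c, d⟩
  simp [M1, M2, Pmat, Matrix.mul_apply, Fintype.sum_prod_type, apply_ite (algebraMap ℂ A),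
    ite_and]

lemma Pmat_mul_M2 {A : Type} [Ring A] [Algebra ℂ A] {n : ℕ} (X : Fin n → Fin n → A) :
    (Pmat n).map (algebraMap ℂ A) * M2 X = M1 X * (Pmat n).map (algebraMap ℂ A) := by
  ext ⟨a, b⟩ ⟨c, d⟩
  simp [M1, M2, Pmat, Matrix.mul_apply, Fintype.sum_prod_type, apply_ite (algebraMap ℂ A),
    ite_and]

/-- An `RLL` relation written in terms of `Ř = P R`. -/
lemma Rcheck_mul_M1_mul_M2 {A : Type} [Ring A] [Algebra ℂ A] {q : ℂ} {n : ℕ}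
    {X Y : Fin n → Fin n → A}
    (h : (Rmat q n).map (algebraMap ℂ A) * M1 X * M2 Y =
      M2 Y * M1 X * (Rmat q n).map (algebraMap ℂ A)) :
    (Rcheck q n).map (algebraMap ℂ A) * M1 X * M2 Y =
      M1 Y * M2 X * (Rcheck q n).map (algebraMap ℂ A) := by
  rw [Rcheck, Matrix.map_mul]
  calc _ = (Pmat n).map (algebraMap ℂ A) *
        ((Rmat q n).map (algebraMap ℂ A) * M1 X * M2 Y) := by simp only [mul_assoc]
    _ = (Pmat n).map (algebraMap ℂ A) * M2 Y * M1 X * (Rmat q n).map (algebraMap ℂ A) := by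
      rw [h]; simp only [mul_assoc]
    _ = M1 Y * ((Pmat n).map (algebraMap ℂ A) * M1 X) * (Rmat q n).map (algebraMap ℂ A) := by
      rw [Pmat_mul_M2]; simp only [mul_assoc]
    _ = _ := by rw [Pmat_mul_M1]; simp only [mul_assoc]

lemma M1_map {F G : Type} [Ring F] [Ring G] (f : F →+* G) {n : ℕ} (X : Fin n → Fin n → F) :
    (M1 X).map f = M1 fun i j => f (X i j) := by
  ext p r
  simp [M1, apply_ite f]

lemma M2_map {F G : Type} [Ring F] [Ring G] (f : F →+* G) {n : ℕ} (X : Fin n → Fin n → F) :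
    (M2 X).map f = M2 fun i j => f (X i j) := by
  ext p r
  simp [M2, apply_ite f]

/-- An `RLL` relation imposed on the free algebra holds in `U_q(gl_n)`. -/
lemma Uq_rll {q : ℂ} {n : ℕ} {X Y : Fin n → Fin n → FreeAlgebra ℂ (UqGen n)}
    (h : ∀ x y, UqRel q n ((RmatU q n * M1 X * M2 Y) x y) ((M2 Y * M1 X * RmatU q n) x y)) :
    (Rmat q n).map (algebraMap ℂ (Uq q n)) *
        M1 (fun i j => RingQuot.mkAlgHom ℂ (UqRel q n) (X i j)) *
        M2 (fun i j => RingQuot.mkAlgHom ℂ (UqRel q n) (Y i j)) =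
      M2 (fun i j => RingQuot.mkAlgHom ℂ (UqRel q n) (Y i j)) *
        M1 (fun i j => RingQuot.mkAlgHom ℂ (UqRel q n) (X i j)) *
        (Rmat q n).map (algebraMap ℂ (Uq q n)) := by
  let f : FreeAlgebra ℂ (UqGen n) →+* Uq q n := (RingQuot.mkAlgHom ℂ (UqRel q n)).toRingHom
  have hR : (RmatU q n).map f = (Rmat q n).map (algebraMap ℂ (Uq q n)) := by
    ext x y
    exact (RingQuot.mkAlgHom ℂ (UqRel q n)).commutes _
  have hm : (RmatU q n * M1 X * M2 Y).map f = (M2 Y * M1 X * RmatU q n).map f := by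
    ext x y
    exact RingQuot.mkAlgHom_rel ℂ (h x y)
  rw [Matrix.map_mul, Matrix.map_mul, Matrix.map_mul, Matrix.map_mul, M1_map, M2_map, hR] at hm
  exact hm

/-- Deduction of the reflection equation for `a₁ k₁`, with `kᵢ = bᵢ⁻¹`, from the `RLL` relations
in braided form. -/
lemma reflection_of_braided {S : Type*} [Monoid S] {r a₁ a₂ b₁ b₂ k₁ k₂ : S}
    (hk₁ : k₁ * b₁ = 1) (hb₁ : b₁ * k₁ = 1) (hk₂ : k₂ * b₂ = 1) (hb₂ : b₂ * k₂ = 1)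
    (haa : r * a₁ * a₂ = a₁ * a₂ * r) (hbb : r * b₁ * b₂ = b₁ * b₂ * r)
    (hab : r * a₁ * b₂ = b₁ * a₂ * r) :
    r * (a₁ * k₁) * r * (a₁ * k₁) = a₁ * k₁ * r * (a₁ * k₁) * r := by
  have hcross : k₁ * r * a₁ = a₂ * r * k₂ := by
    calc k₁ * r * a₁ = k₁ * (r * a₁ * b₂) * k₂ := by simp only [mul_assoc, hb₂, mul_one]
      _ = k₁ * b₁ * a₂ * r * k₂ := by rw [hab]; simp only [mul_assoc]
      _ = a₂ * r * k₂ := by rw [hk₁, one_mul]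
  have hkk : r * (k₂ * k₁) = k₂ * k₁ * r := by
    have hl : k₂ * k₁ * (b₁ * b₂) = 1 := by
      rw [mul_assoc, ← mul_assoc k₁, hk₁, one_mul, hk₂]
    have hr : b₁ * b₂ * (k₂ * k₁) = 1 := by
      rw [mul_assoc, ← mul_assoc b₂, hb₂, one_mul, hb₁]
    calc r * (k₂ * k₁) = k₂ * k₁ * (b₁ * b₂) * r * (k₂ * k₁) := by rw [hl, one_mul]
      _ = k₂ * k₁ * (r * b₁ * b₂) * (k₂ * k₁) := by rw [hbb]; simp only [mul_assoc]
      _ = k₂ * k₁ * r * (b₁ * b₂ * (k₂ * k₁)) := by simp only [mul_assoc]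
      _ = k₂ * k₁ * r := by rw [hr, mul_one]
  calc r * (a₁ * k₁) * r * (a₁ * k₁) = r * a₁ * (k₁ * r * a₁) * k₁ := by simp only [mul_assoc]
    _ = r * a₁ * a₂ * r * (k₂ * k₁) := by rw [hcross]; simp only [mul_assoc]
    _ = a₁ * a₂ * r * (r * (k₂ * k₁)) := by rw [haa]; simp only [mul_assoc]
    _ = a₁ * (a₂ * r * k₂) * k₁ * r := by
      rw [hkk]; simp only [mul_assoc]
    _ = a₁ * k₁ * r * (a₁ * k₁) * r := by rw [← hcross]; simp only [mul_assoc]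

/-- the matrix `L = L⁺(L⁻)⁻¹` satisfies the reflection equation
`Ř L₁ Ř L₁ = L₁ Ř L₁ Ř` in `End ℂⁿ ⊗ End ℂⁿ ⊗ U_q(gl_n)`. -/
theorem reflection_equation (n : ℕ) (hn : 1 ≤ n) (q : ℂ) (hq : q ≠ 0)
    (hq' : NotRootOfUnity q)
    (K : Matrix (Fin n) (Fin n) (Uq q n)) (hK1 : Lm q n * K = 1) (hK2 : K * Lm q n = 1) :
    (Rcheck q n).map (algebraMap ℂ (Uq q n)) * M1 (fun i j => Lmat q n K i j) *
        (Rcheck q n).map (algebraMap ℂ (Uq q n)) * M1 (fun i j => Lmat q n K i j) =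
      M1 (fun i j => Lmat q n K i j) * (Rcheck q n).map (algebraMap ℂ (Uq q n)) *
        M1 (fun i j => Lmat q n K i j) * (Rcheck q n).map (algebraMap ℂ (Uq q n)) := by
  have h₁ : ∀ X Y : Matrix (Fin n) (Fin n) (Uq q n), X * Y = 1 → M1 X * M1 Y = 1 :=
    fun X Y h => by rw [← M1_mul, h, M1_one]
  have h₂ : ∀ X Y : Matrix (Fin n) (Fin n) (Uq q n), X * Y = 1 → M2 X * M2 Y = 1 :=
    fun X Y h => by rw [← M2_mul, h, M2_one]
  change _ * M1 (Lp q n * K) * _ * M1 (Lp q n * K) = M1 (Lp q n * K) * _ * M1 (Lp q n * K) * _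
  rw [M1_mul]
  exact reflection_of_braided (h₁ _ _ hK2) (h₁ _ _ hK1) (h₂ _ _ hK2) (h₂ _ _ hK1)
    (Rcheck_mul_M1_mul_M2 (Uq_rll UqRel.rllPP)) (Rcheck_mul_M1_mul_M2 (Uq_rll UqRel.rllMM))
    (Rcheck_mul_M1_mul_M2 (Uq_rll UqRel.rllPM))

end QImm
end
end
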